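/- Let q be a power of a prime p and 𝔽_q the field with q elements. Let F be a commutative 𝔽_q-algebra, let s and n be natural numbers, let t_1, …, t_s, γ ∈ F, and let d be a natural number with d(q − 1) > s + ℓ_q(n). Then ∑_{a ∈ A_{+,d}} a(t_1) ⋯ a(t_s) · a(γ)^n = 0 in F. -/

import Mathlib

open Polynomial in
/-- Over a field with `q` elements, evaluation commutes with the `q`-power map. -/
theorem FiniteField.aeval_pow_card {K A : Type*} [Field K] [Fintype K] [CommRing A]
    [Algebra K A] (x : A) (a : K[X]) :
    aeval x a ^ Fintype.card K = aeval (x ^ Fintype.card K) a := by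
  rw [← map_pow, ← FiniteField.expand_card, expand_aeval]

open Polynomial in
/-- An `n`-th power of an evaluation, with `n` given by base-`q` digits, is a product of as many
evaluations as the sum of the digits. -/
theorem FiniteField.exists_aeval_pow_ofDigits_eq_prod {K A : Type*} [Field K] [Fintype K]
    [CommRing A] [Algebra K A] (L : List ℕ) (x : A) :
    ∃ M : Multiset A, M.card = L.sum ∧
      ∀ a : K[X], aeval x a ^ Nat.ofDigits (Fintype.card K) L = (M.map (aeval · a)).prod := by
  induction L generalizing x with
  | nil => exact ⟨0, by simp, by simp⟩
  | cons h L ih =>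
    obtain ⟨M, hM, hprod⟩ := ih (x ^ Fintype.card K)
    refine ⟨Multiset.replicate h x + M, by simp [hM], fun a => ?_⟩
    simp [Nat.ofDigits_cons, pow_add, pow_mul, FiniteField.aeval_pow_card, hprod]

/-- Chevalley's vanishing of sums over `σ → K` for polynomials of low degree whose coefficients lie
in a `K`-algebra. -/
theorem MvPolynomial.sum_eval_algebraMap_eq_zero {K A σ : Type*} [Field K] [Fintype K]
    [CommRing A] [Algebra K A] [Fintype σ] [DecidableEq σ] (f : MvPolynomial σ A)
    (hf : f.totalDegree < (Fintype.card K - 1) * Fintype.card σ) :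
    ∑ x : σ → K, eval (fun i => algebraMap K A (x i)) f = 0 := by
  simp only [eval_eq']
  rw [Finset.sum_comm]
  refine Finset.sum_eq_zero fun m hm => ?_
  have h := MvPolynomial.sum_eval_eq_zero (K := K) (monomial m 1)
    (lt_of_le_of_lt ((totalDegree_monomial_le m 1).trans (le_totalDegree hm)) hf)
  have h' := congrArg (algebraMap K A) h
  rw [← Finset.mul_sum]
  simp only [eval_monomial, one_mul, map_sum, map_zero, Finsupp.prod_fintype, pow_zero,
    implies_true, map_prod, map_pow] at h'
  rw [h', mul_zero]

open Polynomial in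
/-- A sum over monic polynomials of degree `d` of a product of fewer than `(q - 1) d` evaluations
vanishes. -/
theorem FiniteField.finsum_monic_prod_aeval_eq_zero {K A : Type*} [Field K] [Fintype K]
    [CommRing A] [Algebra K A] (d : ℕ) (M : Multiset A)
    (hM : M.card < (Fintype.card K - 1) * d) :
    ∑ᶠ a ∈ {a : K[X] | a.Monic ∧ a.natDegree = d}, (M.map (aeval · a)).prod = 0 := by
  let e : (Fin d → K) ≃ {a : K[X] | a.Monic ∧ a.natDegree = d} :=
    (degreeLTEquiv K d).symm.toEquiv.trans (monicEquivDegreeLT d).symm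
  have he (c : Fin d → K) : (e c : K[X]) = X ^ d + ∑ i : Fin d, monomial i (c i) := rfl
  let g (u : A) : MvPolynomial (Fin d) A :=
    MvPolynomial.C (u ^ d) + ∑ i : Fin d, MvPolynomial.C (u ^ (i : ℕ)) * MvPolynomial.X i
  have hg (u : A) : (g u).totalDegree ≤ 1 := by
    refine (MvPolynomial.totalDegree_add _ _).trans (max_le (by rw [MvPolynomial.totalDegree_C]; omega) ?_)
    refine MvPolynomial.totalDegree_finsetSum_le fun i _ => ?_
    refine (MvPolynomial.totalDegree_mul _ _).trans ?_
    rw [MvPolynomial.totalDegree_C, zero_add]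
    exact (MvPolynomial.totalDegree_monomial_le _ _).trans (by simp)
  have hdeg : (M.map g).prod.totalDegree ≤ M.card := by
    refine (MvPolynomial.totalDegree_multiset_prod _).trans ?_
    rw [Multiset.map_map]
    refine (Multiset.sum_le_card_nsmul _ 1 ?_).trans (by simp)
    simpa using fun u _ => hg u
  have hsum := MvPolynomial.sum_eval_algebraMap_eq_zero (K := K) (M.map g).prod
    (hdeg.trans_lt (by simpa using hM))
  rw [← finsum_set_coe_eq_finsum_mem, ← finsum_comp_equiv e, finsum_eq_sum_of_fintype, ← hsum]
  refine Finset.sum_congr rfl fun c _ => ?_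
  rw [map_multiset_prod, Multiset.map_map]
  refine congrArg Multiset.prod (Multiset.map_congr rfl fun u _ => ?_)
  simp [he, g, aeval_monomial, mul_comm]


/-- Let `q = p^f`, `𝔽_q` the field with `q` elements, `F` a commutative
`𝔽_q`-algebra, `s, n ∈ ℕ`, `t₁, …, t_s, γ ∈ F`, and `d` with `d (q - 1) > s + ℓ_q(n)`.
Then `∑_{a monic, deg a = d} a(t₁) ⋯ a(t_s) · a(γ)^n = 0` in `F`. -/
theorem stmt_5 (p f q : ℕ) (hp : p.Prime) (hf : 0 < f) (hq : q = p ^ f)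
    (Fq : Type*) [Field Fq] [Fintype Fq] (hcard : Fintype.card Fq = q)
    (F : Type*) [CommRing F] [Algebra Fq F]
    (s n : ℕ) (t : Fin s → F) (γ : F) (d : ℕ)
    (hd : s + (Nat.digits q n).sum < d * (q - 1)) :
    ∑ᶠ a ∈ {a : Polynomial Fq | a.Monic ∧ a.natDegree = d},
      (∏ i, Polynomial.aeval (t i) a) * (Polynomial.aeval γ a) ^ n = 0 := by
  subst hcard
  obtain ⟨M, hM, hprod⟩ :=
    FiniteField.exists_aeval_pow_ofDigits_eq_prod (K := Fq) (Nat.digits (Fintype.card Fq) n) γ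
  rw [Nat.ofDigits_digits] at hprod
  rw [← FiniteField.finsum_monic_prod_aeval_eq_zero (K := Fq) d (Finset.univ.val.map t + M)
    (by simpa [hM, mul_comm] using hd)]
  simp [hprod, Finset.prod, Function.comp_def]
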